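/- (Existence and uniqueness of the optimal map.) Assume (X,d) is a proper, geodesic, non-branching complete separable metric space, the Borel measure m satisfies the evolution estimate with rate f, and the restriction of m to the compact set K is a doubling measure. Let μ₀,μ₁ be Borel probability measures with supp(μ₀),supp(μ₁)⊂K and μ₀≪m. Then there is at most one coupling π∈Π(μ₀,μ₁) with π(Γ)=1, and any such coupling is induced by an m-measurable map T:X→X, i.e. π=(id,T)_♯μ₀. -/

import Mathlib

open Set Metric MeasureTheory

/-- A geodesic parametrized on `[0,1]`: `d(γ_s,γ_t) = |s-t| · d(γ_0,γ_1)`. -/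
def IsGeodesic {X : Type*} [MetricSpace X] (γ : ℝ → X) : Prop :=
  ∀ s ∈ Set.Icc (0:ℝ) 1, ∀ t ∈ Set.Icc (0:ℝ) 1,
    dist (γ s) (γ t) = |s - t| * dist (γ 0) (γ 1)

/-- A geodesic metric space: every pair of points is joined by a geodesic. -/
def GeodesicMetricSpace (X : Type*) [MetricSpace X] : Prop :=
  ∀ x y : X, ∃ γ : ℝ → X, IsGeodesic γ ∧ γ 0 = x ∧ γ 1 = y

/-- Non-branching: two geodesics agreeing on `[0,t]` for some `t ∈ (0,1)` agree on `[0,1]`. -/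
def NonBranching (X : Type*) [MetricSpace X] : Prop :=
  ∀ γ₁ γ₂ : ℝ → X, IsGeodesic γ₁ → IsGeodesic γ₂ →
    ∀ t ∈ Set.Ioo (0:ℝ) 1, (∀ s ∈ Set.Icc (0:ℝ) t, γ₁ s = γ₂ s) →
      ∀ s ∈ Set.Icc (0:ℝ) 1, γ₁ s = γ₂ s

/-- The evolution set `A_{t,Λ} = {γ_t : γ geodesic, γ_0 ∈ A, (γ_0,γ_1) ∈ Λ}`. -/
def evoSet {X : Type*} [MetricSpace X] (A : Set X) (Λ : Set (X × X)) (t : ℝ) : Set X :=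
  {z | ∃ γ : ℝ → X, IsGeodesic γ ∧ γ 0 ∈ A ∧ (γ 0, γ 1) ∈ Λ ∧ γ t = z}

/-- `m` satisfies the evolution estimate with rate `f` (a consequence of `MCP(K,N)`):
`f : [0,1] → [0,1]` is continuous, `f(0) = 1`, and `m(E_{t,E×{y}}) ≥ f(t)·m(E)` for every
compact `E`, every `y` and every `t ∈ [0,1]`. -/
def EvolutionEstimate {X : Type*} [MetricSpace X] [MeasurableSpace X]
    (m : Measure X) (f : ℝ → ℝ) : Prop :=
  ContinuousOn f (Set.Icc 0 1) ∧ f 0 = 1 ∧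
    (∀ t ∈ Set.Icc (0:ℝ) 1, f t ∈ Set.Icc (0:ℝ) 1) ∧
    ∀ E : Set X, IsCompact E → ∀ y : X, ∀ t ∈ Set.Icc (0:ℝ) 1,
      ENNReal.ofReal (f t) * m E ≤ m (evoSet E (E ×ˢ ({y} : Set X)) t)

/-- The contact set `Γ = {(x,y) ∈ K × K : φ(x) + φᶜ(y) = c(x,y)}`. -/
def contactSet {X : Type*} [MetricSpace X] (h : ℝ → ℝ) (φ φc : X → ℝ) (K : Set X) :
    Set (X × X) :=
  {p | p.1 ∈ K ∧ p.2 ∈ K ∧ φ p.1 + φc p.2 = h (dist p.1 p.2)}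

/-- `π` is a coupling of `(μ₀, μ₁)`: a probability measure on `X × X` with marginals
`μ₀` and `μ₁`. -/
def IsCoupling {X : Type*} [MeasurableSpace X] (π : Measure (X × X))
    (μ₀ μ₁ : Measure X) : Prop :=
  IsProbabilityMeasure π ∧ π.map Prod.fst = μ₀ ∧ π.map Prod.snd = μ₁

/-- `Γ_E = Γ ∩ (E × X)` where `E` is the set of `x` whose fiber `({x} × X) ∩ Γ` is
not a singleton. -/
def branchSet {X : Type*} (Γ : Set (X × X)) : Set (X × X) :=
  {p ∈ Γ | ∃ w, w ≠ p.2 ∧ (p.1, w) ∈ Γ}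

section Auxiliary

open Filter Topology

/-- The points dividing the segment from `x` to `y` in the ratio `t : 1 - t`. -/
def DividesAt {X : Type*} [MetricSpace X] (t : ℝ) (x y z : X) : Prop :=
  dist x z = t * dist x y ∧ dist z y = (1 - t) * dist x y

/-- The points dividing in the ratio `t : 1 - t` the segment between some pair in `Λ`. -/
def divisionSet {X : Type*} [MetricSpace X] (t : ℝ) (Λ : Set (X × X)) : Set X :=
  {z | ∃ p ∈ Λ, DividesAt t p.1 p.2 z}

theorem StrictConvexOn.strictMonoOn_of_monotoneOn {s : Set ℝ} {h : ℝ → ℝ}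
    (hconv : StrictConvexOn ℝ s h) (hmono : MonotoneOn h s) : StrictMonoOn h s := by
  intro a ha b hb hab
  by_contra hle
  have hmem : (1 / 2 : ℝ) • a + (1 / 2 : ℝ) • b ∈ s :=
    hconv.1 ha hb (by norm_num) (by norm_num) (by norm_num)
  have h1 := hconv.2 ha hb hab.ne (one_half_pos (α := ℝ)) one_half_pos (add_halves 1)
  have h2 := hmono ha hmem (by simp only [smul_eq_mul]; linarith)
  simp only [smul_eq_mul] at h1 h2
  linarith

theorem ConvexOn.continuousOn_Ici_of_monotoneOn {h : ℝ → ℝ}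
    (hconv : ConvexOn ℝ (Ici 0) h) (hmono : MonotoneOn h (Ici 0)) :
    ContinuousOn h (Ici 0) := by
  intro x hx
  rcases eq_or_lt_of_le (mem_Ici.1 hx) with rfl | hx0
  · have hlim : Tendsto (fun t : ℝ => (1 - t) * h 0 + t * h 1) (𝓝[Ici 0] 0) (𝓝 (h 0)) := by
      have : Continuous fun t : ℝ => (1 - t) * h 0 + t * h 1 := by fun_prop
      simpa using (this.tendsto 0).mono_left nhdsWithin_le_nhds
    refine tendsto_of_tendsto_of_tendsto_of_le_of_le' tendsto_const_nhds hlim ?_ ?_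
    · filter_upwards [self_mem_nhdsWithin] with t ht
      exact hmono self_mem_Ici ht ht
    · filter_upwards [self_mem_nhdsWithin, nhdsWithin_le_nhds (Iio_mem_nhds one_pos)]
        with t ht ht1
      have := hconv.2 (self_mem_Ici (a := (0 : ℝ))) (mem_Ici.2 zero_le_one)
        (sub_nonneg.2 (le_of_lt ht1)) ht (by ring)
      simpa using this
  · have := (hconv.subset Ioi_subset_Ici_self (convex_Ioi 0)).continuousOn isOpen_Ioi
    exact (this.continuousAt (Ioi_mem_nhds hx0)).continuousWithinAt

theorem isGeodesic_of_dist_le {X : Type*} [MetricSpace X] {γ : ℝ → X}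
    (hγ : ∀ s ∈ Icc (0 : ℝ) 1, ∀ t ∈ Icc (0 : ℝ) 1, s ≤ t →
      dist (γ s) (γ t) ≤ (t - s) * dist (γ 0) (γ 1)) : IsGeodesic γ := by
  have key : ∀ s ∈ Icc (0 : ℝ) 1, ∀ t ∈ Icc (0 : ℝ) 1, s ≤ t →
      dist (γ s) (γ t) = (t - s) * dist (γ 0) (γ 1) := by
    intro s hs t ht hst
    have h1 := hγ 0 (by simp) s hs hs.1
    have h2 := hγ s hs t ht hst
    have h3 := hγ t ht 1 (by simp) ht.2
    have h4 := dist_triangle4 (γ 0) (γ s) (γ t) (γ 1)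
    refine le_antisymm h2 ?_
    linarith
  intro s hs t ht
  rcases le_total s t with hst | hst
  · rw [key s hs t ht hst, abs_of_nonpos (by linarith), neg_sub]
  · rw [dist_comm, key t ht s hs hst, abs_of_nonneg (by linarith)]

theorem IsGeodesic.concat {X : Type*} [MetricSpace X] {α β : ℝ → X} {t : ℝ}
    (ht : t ∈ Ioo (0 : ℝ) 1) (hα : IsGeodesic α) (hβ : IsGeodesic β) (hαβ : α 1 = β 0)
    (hd : DividesAt t (α 0) (β 1) (α 1)) :
    IsGeodesic fun s => if s ≤ t then α (s / t) else β ((s - t) / (1 - t)) := by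
  obtain ⟨ht0, ht1⟩ := ht
  have ht1' : 0 < 1 - t := by linarith
  obtain ⟨hd1, hd2⟩ := hd
  rw [hαβ] at hd2
  have mα : ∀ s ∈ Icc (0 : ℝ) 1, s ≤ t → s / t ∈ Icc (0 : ℝ) 1 := fun s hs hst =>
    ⟨div_nonneg hs.1 ht0.le, (div_le_one ht0).2 hst⟩
  have mβ : ∀ s ∈ Icc (0 : ℝ) 1, t ≤ s → (s - t) / (1 - t) ∈ Icc (0 : ℝ) 1 := fun s hs hst =>
    ⟨div_nonneg (by linarith) ht1'.le, (div_le_one ht1').2 (by linarith [hs.2])⟩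
  have dα : ∀ s ∈ Icc (0 : ℝ) 1, ∀ r, r ∈ Icc (0 : ℝ) 1 → s ≤ r → r ≤ t →
      dist (α (s / t)) (α (r / t)) = (r - s) * dist (α 0) (β 1) := by
    intro s hs r hr hsr hrt
    rw [hα _ (mα s hs (hsr.trans hrt)) _ (mα r hr hrt), hd1, ← sub_div, abs_div,
      abs_of_pos ht0, abs_of_nonpos (by linarith)]
    field_simp
    ring
  have dβ : ∀ s ∈ Icc (0 : ℝ) 1, ∀ r, r ∈ Icc (0 : ℝ) 1 → s ≤ r → t ≤ s →
      dist (β ((s - t) / (1 - t))) (β ((r - t) / (1 - t))) = (r - s) * dist (α 0) (β 1) := by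
    intro s hs r hr hsr hts
    rw [hβ _ (mβ s hs hts) _ (mβ r hr (hts.trans hsr)), hd2, ← sub_div, abs_div,
      abs_of_pos ht1', abs_of_nonpos (by linarith)]
    field_simp
    ring
  have htmem : t ∈ Icc (0 : ℝ) 1 := ⟨ht0.le, ht1.le⟩
  apply isGeodesic_of_dist_le
  have e0 : (if (0 : ℝ) ≤ t then α (0 / t) else β ((0 - t) / (1 - t))) = α 0 := by
    simp [ht0.le]
  have e1 : (if (1 : ℝ) ≤ t then α (1 / t) else β ((1 - t) / (1 - t))) = β 1 := by
    simp [ht1.not_ge, div_self ht1'.ne']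
  intro s hs r hr hsr
  simp only [e0, e1]
  by_cases hrt : r ≤ t
  · rw [if_pos (hsr.trans hrt), if_pos hrt, dα s hs r hr hsr hrt]
  by_cases hst : s ≤ t
  · rw [if_pos hst, if_neg hrt]
    have h1 := dα s hs t htmem hst le_rfl
    have h2 := dβ t htmem r hr (le_of_not_ge hrt) le_rfl
    rw [div_self ht0.ne'] at h1
    rw [sub_self, zero_div, ← hαβ] at h2
    have := dist_triangle (α (s / t)) (α 1) (β ((r - t) / (1 - t)))
    linarith
  · rw [if_neg hst, if_neg hrt, dβ s hs r hr hsr (le_of_not_ge hst)]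

theorem NonBranching.eq_of_dividesAt {X : Type*} [MetricSpace X]
    (hgeo : GeodesicMetricSpace X) (hnb : NonBranching X) {t : ℝ} (ht : t ∈ Ioo (0 : ℝ) 1)
    {x y y' z : X} (hy : DividesAt t x y z) (hy' : DividesAt t x y' z) : y = y' := by
  obtain ⟨α, hα, rfl, rfl⟩ := hgeo x z
  obtain ⟨β, hβ, hβ0, rfl⟩ := hgeo (α 1) y
  obtain ⟨β', hβ', hβ0', rfl⟩ := hgeo (α 1) y'
  have := hnb _ _ (hα.concat ht hβ hβ0.symm hy) (hα.concat ht hβ' hβ0'.symm hy') t ht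
    (fun s hs => by simp [hs.2]) 1 (by simp)
  simpa [ht.2.not_ge, div_self (sub_pos.2 ht.2).ne'] using this

/-- If transporting `x₁` to `y₁` and `x₂` to `y₂` is no more expensive than the swapped
transport, then the two segments cannot cross at the same time unless they share the endpoint. -/
theorem eq_of_dividesAt_of_cost_le_swap {X : Type*} [MetricSpace X]
    (hgeo : GeodesicMetricSpace X) (hnb : NonBranching X) {h : ℝ → ℝ}
    (hconv : StrictConvexOn ℝ (Ici (0 : ℝ)) h) (hmono : MonotoneOn h (Ici (0 : ℝ)))
    {t : ℝ} (ht : t ∈ Ioo (0 : ℝ) 1) {x₁ y₁ x₂ y₂ z : X}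
    (h₁ : DividesAt t x₁ y₁ z) (h₂ : DividesAt t x₂ y₂ z)
    (hc : h (dist x₁ y₁) + h (dist x₂ y₂) ≤ h (dist x₁ y₂) + h (dist x₂ y₁)) : y₁ = y₂ := by
  obtain ⟨ht0, ht1⟩ := ht
  have ht1' : 0 < 1 - t := by linarith
  have hstrict := hconv.strictMonoOn_of_monotoneOn hmono
  have t1 : dist x₁ y₂ ≤ t * dist x₁ y₁ + (1 - t) * dist x₂ y₂ := by
    have := dist_triangle x₁ z y₂
    rwa [h₁.1, h₂.2] at this
  have t2 : dist x₂ y₁ ≤ t * dist x₂ y₂ + (1 - t) * dist x₁ y₁ := by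
    have := dist_triangle x₂ z y₁
    rwa [h₂.1, h₁.2] at this
  have n1 : dist x₁ y₁ ∈ Ici (0 : ℝ) := dist_nonneg
  have n2 : dist x₂ y₂ ∈ Ici (0 : ℝ) := dist_nonneg
  have n3 : dist x₁ y₂ ∈ Ici (0 : ℝ) := dist_nonneg
  have n4 : dist x₂ y₁ ∈ Ici (0 : ℝ) := dist_nonneg
  have m1 : t * dist x₁ y₁ + (1 - t) * dist x₂ y₂ ∈ Ici (0 : ℝ) := n3.trans t1
  have m2 : t * dist x₂ y₂ + (1 - t) * dist x₁ y₁ ∈ Ici (0 : ℝ) := n4.trans t2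
  have k1 := hmono n3 m1 t1
  have k2 := hmono n4 m2 t2
  have hd : dist x₁ y₁ = dist x₂ y₂ := by
    by_contra hne
    have c1 := hconv.2 n1 n2 hne ht0 ht1' (by ring)
    have c2 := hconv.2 n2 n1 (Ne.symm hne) ht0 ht1' (by ring)
    simp only [smul_eq_mul] at c1 c2
    linarith
  have hd' : dist x₁ y₂ = dist x₁ y₁ := by
    rw [← hd] at t1 t2 hc
    ring_nf at t1 t2
    have k2 := hmono n4 n1 t2
    refine le_antisymm t1 (le_of_not_gt fun hlt => ?_)
    have := hstrict n3 n1 hlt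
    linarith
  refine NonBranching.eq_of_dividesAt hgeo hnb ⟨ht0, ht1⟩ h₁ ⟨?_, ?_⟩
  · rw [hd', h₁.1]
  · rw [hd', h₂.2, hd]

theorem evoSet_subset_divisionSet {X : Type*} [MetricSpace X] {A : Set X} {Λ : Set (X × X)}
    {t : ℝ} (ht : t ∈ Icc (0 : ℝ) 1) : evoSet A Λ t ⊆ divisionSet t Λ := by
  rintro z ⟨γ, hγ, -, hΛ, rfl⟩
  refine ⟨_, hΛ, ?_, ?_⟩
  · rw [hγ 0 (by simp) t ht, zero_sub, abs_neg, abs_of_nonneg ht.1]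
  · rw [hγ t ht 1 (by simp), abs_of_nonpos (by linarith [ht.2]), neg_sub]

theorem IsCompact.isClosed_divisionSet {X : Type*} [MetricSpace X] {Λ : Set (X × X)}
    (hΛ : IsCompact Λ) (t : ℝ) : IsClosed (divisionSet t Λ) := by
  have : CompactSpace Λ := isCompact_iff_compactSpace.1 hΛ
  have hcl : IsClosed {q : Λ × X | DividesAt t q.1.1.1 q.1.1.2 q.2} := by
    refine IsClosed.inter (isClosed_eq ?_ ?_) (isClosed_eq ?_ ?_) <;> fun_prop
  convert isClosedMap_snd_of_compactSpace _ hcl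
  ext z
  simp [divisionSet]

theorem divisionSet_mono {X : Type*} [MetricSpace X] {Λ Λ' : Set (X × X)} (hΛ : Λ ⊆ Λ')
    (t : ℝ) : divisionSet t Λ ⊆ divisionSet t Λ' :=
  fun _ ⟨p, hp, hz⟩ => ⟨p, hΛ hp, hz⟩

theorem divisionSet_subset_cthickening {X : Type*} [MetricSpace X] {A : Set X}
    {Λ : Set (X × X)} {t D : ℝ} (ht : 0 ≤ t) (hA : ∀ p ∈ Λ, p.1 ∈ A)
    (hD : ∀ p ∈ Λ, dist p.1 p.2 ≤ D) : divisionSet t Λ ⊆ cthickening (t * D) A := by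
  rintro z ⟨p, hp, hz⟩
  refine mem_cthickening_of_dist_le z p.1 _ A (hA p hp) ?_
  rw [dist_comm, hz.1]
  exact mul_le_mul_of_nonneg_left (hD p hp) ht

theorem divisionSet_iInter_subset {X : Type*} [MetricSpace X] {Λ : ℕ → Set (X × X)}
    (hanti : Antitone Λ) (hΛ : ∀ n, IsCompact (Λ n)) (t : ℝ) :
    ⋂ n, divisionSet t (Λ n) ⊆ divisionSet t (⋂ n, Λ n) := by
  intro z hz
  have hcl : IsClosed {p : X × X | DividesAt t p.1 p.2 z} := by
    refine IsClosed.inter (isClosed_eq ?_ ?_) (isClosed_eq ?_ ?_) <;> fun_prop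
  have hne := IsCompact.nonempty_iInter_of_sequence_nonempty_isCompact_isClosed
    (fun n => Λ n ∩ {p : X × X | DividesAt t p.1 p.2 z})
    (fun n => inter_subset_inter_left _ (hanti n.le_succ))
    (fun n => (mem_iInter.1 hz n)) ((hΛ 0).inter_right hcl)
    (fun n => ((hΛ n).inter_right hcl).isClosed)
  obtain ⟨p, hp⟩ := hne
  rw [mem_iInter] at hp
  exact ⟨p, mem_iInter.2 fun n => (hp n).1, (hp 0).2⟩

theorem IsCompact.sep_le {Y : Type*} [TopologicalSpace Y] [T2Space Y] {S : Set Y}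
    (hS : IsCompact S) {g k : Y → ℝ} (hg : ContinuousOn g S) (hk : ContinuousOn k S) :
    IsCompact {p ∈ S | g p ≤ k p} := by
  have := (hk.sub hg).preimage_isClosed_of_isClosed hS.isClosed (isClosed_Ici (a := (0 : ℝ)))
  convert hS.inter_right this using 1
  ext p
  simp only [mem_inter_iff, mem_preimage, mem_Ici, sub_nonneg, mem_ofPred_eq, Pi.sub_apply]
  tauto

section Estimate

variable {X : Type*} [MetricSpace X] {h : ℝ → ℝ} {φ φc : X → ℝ} {A B : Set X}

/-- The pairs in `A × B` at which the potentials attain the cost up to an error `δ`. -/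
def almostContactSet (h : ℝ → ℝ) (φ φc : X → ℝ) (A B : Set X) (δ : ℝ) : Set (X × X) :=
  {p ∈ A ×ˢ B | h (dist p.1 p.2) ≤ φ p.1 + φc p.2 + δ}

theorem isCompact_almostContactSet (hcont : ContinuousOn h (Ici 0)) (hA : IsCompact A)
    (hB : IsCompact B) (hφ : ContinuousOn φ A) (hφc : ContinuousOn φc B) (δ : ℝ) :
    IsCompact (almostContactSet h φ φc A B δ) := by
  refine (hA.prod hB).sep_le ?_ ?_
  · exact hcont.comp (by fun_prop) fun p _ => dist_nonneg
  · exact ((hφ.comp continuousOn_fst fun p hp => hp.1).add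
      (hφc.comp continuousOn_snd fun p hp => hp.2)).add continuousOn_const

theorem exists_finset_almostContact (hcont : ContinuousOn h (Ici 0)) (hA : IsCompact A)
    (hφ : ContinuousOn φ A) (hAB : ∀ x ∈ A, ∃ y ∈ B, h (dist x y) ≤ φ x + φc y)
    {δ : ℝ} (hδ : 0 < δ) :
    ∃ Y : Finset X, ↑Y ⊆ B ∧ ∀ x ∈ A, ∃ y ∈ Y, h (dist x y) ≤ φ x + φc y + δ := by
  choose! y hyB hy using hAB
  have hnhds : ∀ x ∈ A, {x' | h (dist x' (y x)) < φ x' + φc (y x) + δ} ∈ 𝓝[A] x := by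
    intro x hx
    have c1 : ContinuousWithinAt (fun x' => h (dist x' (y x))) A x :=
      (hcont.comp (g := h) (f := fun x' => dist x' (y x)) (t := Ici 0) (s := A) (by fun_prop)
        fun p _ => dist_nonneg) x hx
    have c2 : ContinuousWithinAt (fun x' => φ x' + φc (y x) + δ) A x :=
      ((hφ x hx).add continuousWithinAt_const).add continuousWithinAt_const
    exact c1.eventually_lt c2 (by linarith [hy x hx])
  obtain ⟨I, hIA, hI⟩ := hA.elim_nhdsWithin_subcover _ hnhds
  classical
  refine ⟨I.image y, ?_, ?_⟩
  · intro z hz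
    obtain ⟨x, hx, rfl⟩ := Finset.mem_image.1 (Finset.mem_coe.1 hz)
    exact hyB x (hIA x hx)
  · intro x hx
    obtain ⟨i, hi, hxi⟩ := mem_iUnion₂.1 (hI hx)
    exact ⟨y i, Finset.mem_image_of_mem y hi, le_of_lt hxi⟩

variable [MeasurableSpace X] [BorelSpace X]

theorem EvolutionEstimate.le_divisionSet_almostContactSet
    (hgeo : GeodesicMetricSpace X) (hnb : NonBranching X) {m : Measure X}
    {f : ℝ → ℝ} (hm : EvolutionEstimate m f)
    (hconv : StrictConvexOn ℝ (Ici (0 : ℝ)) h) (hmono : MonotoneOn h (Ici (0 : ℝ)))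
    (hA : IsCompact A) (hφ : ContinuousOn φ A)
    (hAB : ∀ x ∈ A, ∃ y ∈ B, h (dist x y) ≤ φ x + φc y)
    {δ : ℝ} (hδ : 0 < δ) {t : ℝ} (ht : t ∈ Ioo (0 : ℝ) 1) :
    ENNReal.ofReal (f t) * m A ≤ m (divisionSet t (almostContactSet h φ φc A B δ)) := by
  have hcont := hconv.convexOn.continuousOn_Ici_of_monotoneOn hmono
  obtain ⟨Y, hYB, hY⟩ := exists_finset_almostContact hcont hA hφ hAB hδ
  have htI : t ∈ Icc (0 : ℝ) 1 := Ioo_subset_Icc_self ht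
  let cell : X → Set X := fun y =>
    {x ∈ A | ∀ y' ∈ Y, h (dist x y) - φc y ≤ h (dist x y') - φc y'}
  have hcA : ∀ y, cell y ⊆ A := fun y x hx => hx.1
  have hccont : ∀ y, ContinuousOn (fun x => h (dist x y) - φc y) A := fun y =>
    (hcont.comp (by fun_prop) fun p _ => dist_nonneg).sub continuousOn_const
  have hcell : ∀ y, IsCompact (cell y) := by
    intro y
    have : cell y = A ∩ ⋂ y' ∈ Y, {x ∈ A | h (dist x y) - φc y ≤ h (dist x y') - φc y'} := by
      ext x
      simp only [cell, mem_inter_iff, mem_iInter, mem_ofPred_eq]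
      exact ⟨fun hx => ⟨hx.1, fun y' hy' => ⟨hx.1, hx.2 y' hy'⟩⟩,
        fun hx => ⟨hx.1, fun y' hy' => (hx.2 y' hy').2⟩⟩
    rw [this]
    exact hA.inter_right (isClosed_biInter fun y' _ =>
      (hA.sep_le (hccont y) (hccont y')).isClosed)
  have hcover : ∀ x ∈ A, ∃ y ∈ Y, x ∈ cell y := by
    intro x hx
    obtain ⟨y₀, hy₀, -⟩ := hY x hx
    obtain ⟨y, hy, hmin⟩ := Y.exists_min_image (fun y => h (dist x y) - φc y) ⟨y₀, hy₀⟩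
    exact ⟨y, hy, hx, hmin⟩
  let V : X → Set X := fun y => divisionSet t (cell y ×ˢ {y})
  have hVmeas : ∀ y, MeasurableSet (V y) := fun y =>
    (((hcell y).prod isCompact_singleton).isClosed_divisionSet t).measurableSet
  have hdisj : (Y : Set X).PairwiseDisjoint V := by
    intro y hy y' hy' hne
    refine Set.disjoint_left.2 ?_
    rintro z ⟨⟨x, w⟩, ⟨hx, hw⟩, hz⟩ ⟨⟨x', w'⟩, ⟨hx', hw'⟩, hz'⟩
    obtain rfl : w = y := hw
    obtain rfl : w' = y' := hw'
    refine hne (eq_of_dividesAt_of_cost_le_swap hgeo hnb hconv hmono ht hz hz' ?_)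
    have h1 := hx.2 w' hy'
    have h2 := hx'.2 w hy
    dsimp only at h1 h2 ⊢
    linarith
  calc ENNReal.ofReal (f t) * m A
      ≤ ENNReal.ofReal (f t) * ∑ y ∈ Y, m (cell y) := by
        gcongr
        refine (measure_mono fun x hx => ?_).trans (measure_biUnion_finset_le Y cell)
        simpa using hcover x hx
    _ = ∑ y ∈ Y, ENNReal.ofReal (f t) * m (cell y) := Finset.mul_sum ..
    _ ≤ ∑ y ∈ Y, m (V y) := Finset.sum_le_sum fun y _ =>
        (hm.2.2.2 _ (hcell y) y t htI).trans (measure_mono (evoSet_subset_divisionSet htI))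
    _ = m (⋃ y ∈ Y, V y) := (measure_biUnion_finset hdisj fun y _ => hVmeas y).symm
    _ ≤ _ := by
        refine measure_mono (iUnion₂_subset fun y hy => divisionSet_mono ?_ t)
        rintro ⟨x, w⟩ ⟨hx, hw⟩
        obtain rfl : w = y := hw
        refine ⟨⟨hx.1, hYB hy⟩, ?_⟩
        obtain ⟨y', hy', hle⟩ := hY x hx.1
        have := hx.2 y' hy'
        dsimp only at this ⊢
        linarith

variable [ProperSpace X]

theorem EvolutionEstimate.le_divisionSet_contact
    (hgeo : GeodesicMetricSpace X) (hnb : NonBranching X) {m : Measure X}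
    [IsFiniteMeasureOnCompacts m] {f : ℝ → ℝ} (hm : EvolutionEstimate m f)
    (hconv : StrictConvexOn ℝ (Ici (0 : ℝ)) h) (hmono : MonotoneOn h (Ici (0 : ℝ)))
    (hA : IsCompact A) (hB : IsCompact B) (hφ : ContinuousOn φ A) (hφc : ContinuousOn φc B)
    (hAB : ∀ x ∈ A, ∃ y ∈ B, h (dist x y) ≤ φ x + φc y)
    {t : ℝ} (ht : t ∈ Ioo (0 : ℝ) 1) :
    ENNReal.ofReal (f t) * m A ≤ m (divisionSet t (almostContactSet h φ φc A B 0)) := by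
  have hcont := hconv.convexOn.continuousOn_Ici_of_monotoneOn hmono
  let δ : ℕ → ℝ := fun n => 1 / ((n : ℝ) + 1)
  have hδ : ∀ n, 0 < δ n := fun n => Nat.one_div_pos_of_nat
  have hcpt := isCompact_almostContactSet hcont hA hB hφ hφc
  let Λ : ℕ → Set (X × X) := fun n => almostContactSet h φ φc A B (δ n)
  have hanti : Antitone Λ := fun n k hnk p hp =>
    ⟨hp.1, hp.2.trans (by gcongr; exact Nat.one_div_le_one_div hnk)⟩
  have hinter : ⋂ n, Λ n ⊆ almostContactSet h φ φc A B 0 := by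
    intro p hp
    rw [mem_iInter] at hp
    refine ⟨(hp 0).1, ge_of_tendsto' (tendsto_const_nhds.add
      tendsto_one_div_add_atTop_nhds_zero_nat) fun n => (hp n).2⟩
  obtain ⟨D, hD⟩ := (hA.prod hB).bddAbove_image
    (f := fun p : X × X => dist p.1 p.2) continuous_dist.continuousOn
  have hfin : m (divisionSet t (Λ 0)) ≠ ⊤ :=
    ((measure_mono (divisionSet_subset_cthickening ht.1.le (fun p hp => hp.1.1)
      fun p hp => hD (mem_image_of_mem _ hp.1))).trans_lt hA.cthickening.measure_lt_top).ne
  have hV : Antitone fun n => divisionSet t (Λ n) := fun n k hnk => divisionSet_mono (hanti hnk) t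
  calc ENNReal.ofReal (f t) * m A
      ≤ ⨅ n, m (divisionSet t (Λ n)) := le_iInf fun n =>
        hm.le_divisionSet_almostContactSet hgeo hnb hconv hmono hA hφ hAB (hδ n) ht
    _ = m (⋂ n, divisionSet t (Λ n)) := (hV.measure_iInter
        (fun n => ((hcpt _).isClosed_divisionSet t).measurableSet.nullMeasurableSet)
        ⟨0, hfin⟩).symm
    _ ≤ _ := measure_mono ((divisionSet_iInter_subset hanti (fun n => hcpt _) t).trans
        (divisionSet_mono hinter t))

/-- A compact set, each point of which is in contact with two disjoint compact sets, is null. -/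
theorem EvolutionEstimate.measure_eq_zero_of_contact_disjoint
    (hgeo : GeodesicMetricSpace X) (hnb : NonBranching X) {m : Measure X}
    [IsFiniteMeasureOnCompacts m] {f : ℝ → ℝ} (hm : EvolutionEstimate m f)
    (hconv : StrictConvexOn ℝ (Ici (0 : ℝ)) h) (hmono : MonotoneOn h (Ici (0 : ℝ)))
    {B₁ B₂ : Set X} (hA : IsCompact A) (hB₁ : IsCompact B₁) (hB₂ : IsCompact B₂)
    (hB : Disjoint B₁ B₂) (hφ : ContinuousOn φ A)
    (hφ₁ : ContinuousOn φc B₁) (hφ₂ : ContinuousOn φc B₂)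
    (hle₁ : ∀ x ∈ A, ∀ y ∈ B₁, φ x + φc y ≤ h (dist x y))
    (hle₂ : ∀ x ∈ A, ∀ y ∈ B₂, φ x + φc y ≤ h (dist x y))
    (hA₁ : ∀ x ∈ A, ∃ y ∈ B₁, h (dist x y) ≤ φ x + φc y)
    (hA₂ : ∀ x ∈ A, ∃ y ∈ B₂, h (dist x y) ≤ φ x + φc y) : m A = 0 := by
  have hcont := hconv.convexOn.continuousOn_Ici_of_monotoneOn hmono
  obtain ⟨D, hD⟩ := (hA.prod (hB₁.union hB₂)).bddAbove_image
    (f := fun p : X × X => dist p.1 p.2) continuous_dist.continuousOn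
  have hbound : ∀ t ∈ Ioo (0 : ℝ) 1,
      2 * (ENNReal.ofReal (f t) * m A) ≤ m (cthickening (t * D) A) := by
    intro t ht
    have hdisj : Disjoint (divisionSet t (almostContactSet h φ φc A B₁ 0))
        (divisionSet t (almostContactSet h φ φc A B₂ 0)) := by
      refine Set.disjoint_left.2 ?_
      rintro z ⟨⟨x, y⟩, ⟨⟨hx, hy⟩, hxy⟩, hz⟩ ⟨⟨x', y'⟩, ⟨⟨hx', hy'⟩, hxy'⟩, hz'⟩
      dsimp only at hx hy hxy hx' hy' hxy' hz hz'
      have h1 := hle₁ x' hx' y hy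
      have h2 := hle₂ x hx y' hy'
      obtain rfl := eq_of_dividesAt_of_cost_le_swap hgeo hnb hconv hmono ht hz hz' (by linarith)
      exact Set.disjoint_left.1 hB hy hy'
    rw [two_mul]
    calc _ ≤ m (divisionSet t (almostContactSet h φ φc A B₁ 0)) +
          m (divisionSet t (almostContactSet h φ φc A B₂ 0)) := add_le_add
            (hm.le_divisionSet_contact hgeo hnb hconv hmono hA hB₁ hφ hφ₁ hA₁ ht)
            (hm.le_divisionSet_contact hgeo hnb hconv hmono hA hB₂ hφ hφ₂ hA₂ ht)
      _ = m (divisionSet t (almostContactSet h φ φc A B₁ 0) ∪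
          divisionSet t (almostContactSet h φ φc A B₂ 0)) := (measure_union hdisj
            ((isCompact_almostContactSet hcont hA hB₂ hφ hφ₂ 0).isClosed_divisionSet
              t).measurableSet).symm
      _ ≤ _ := measure_mono (union_subset
          (divisionSet_subset_cthickening ht.1.le (fun p hp => hp.1.1)
            fun p hp => hD (mem_image_of_mem _ ⟨hp.1.1, Or.inl hp.1.2⟩))
          (divisionSet_subset_cthickening ht.1.le (fun p hp => hp.1.1)
            fun p hp => hD (mem_image_of_mem _ ⟨hp.1.1, Or.inr hp.1.2⟩)))
  have hIoo : Ioo (0 : ℝ) 1 ∈ 𝓝[>] (0 : ℝ) := Ioo_mem_nhdsGT one_pos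
  have hf : Tendsto f (𝓝[>] 0) (𝓝 1) := by
    have := hm.1 0 (by simp)
    rw [ContinuousWithinAt, hm.2.1] at this
    exact this.mono_left (nhdsWithin_le_iff.2 (mem_of_superset hIoo Ioo_subset_Icc_self))
  have hleft : Tendsto (fun t => 2 * (ENNReal.ofReal (f t) * m A)) (𝓝[>] 0) (𝓝 (2 * m A)) := by
    have h1 := ENNReal.Tendsto.mul_const (b := m A) (ENNReal.tendsto_ofReal hf)
      (Or.inr hA.measure_lt_top.ne)
    simpa using ENNReal.Tendsto.const_mul (a := 2) h1 (Or.inr (by simp))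
  have hright : Tendsto (fun t : ℝ => m (cthickening (t * D) A)) (𝓝[>] 0) (𝓝 (m A)) := by
    refine (tendsto_measure_cthickening_of_isCompact hA).comp ?_
    have : Continuous fun t : ℝ => t * D := by fun_prop
    simpa using (this.tendsto 0).mono_left nhdsWithin_le_nhds
  have h2 : 2 * m A ≤ m A := le_of_tendsto_of_tendsto hleft hright
    (mem_of_superset hIoo hbound)
  by_contra h0
  rw [two_mul] at h2
  exact absurd h2 (not_le.2 (ENNReal.lt_add_right hA.measure_lt_top.ne h0))

end Estimate

section Fibers

variable {X : Type*} [MetricSpace X] {Γ : Set (X × X)}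

/-- The base points over which a relation has at least two values. -/
def multivaluedSet (Γ : Set (X × X)) : Set X :=
  {x | ∃ y y', y ≠ y' ∧ (x, y) ∈ Γ ∧ (x, y') ∈ Γ}

theorem multivaluedSet_eq_iUnion [ProperSpace X] [Nonempty X] (Γ : Set (X × X)) :
    multivaluedSet Γ = ⋃ i : ℕ × ℕ × ℕ,
      ⋃ _ : Disjoint (closedBall (TopologicalSpace.denseSeq X i.1) (1 / ((i.2.2 : ℝ) + 1)))
        (closedBall (TopologicalSpace.denseSeq X i.2.1) (1 / ((i.2.2 : ℝ) + 1))),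
      Prod.fst '' (Γ ∩ univ ×ˢ
        closedBall (TopologicalSpace.denseSeq X i.1) (1 / ((i.2.2 : ℝ) + 1))) ∩
      Prod.fst '' (Γ ∩ univ ×ˢ
        closedBall (TopologicalSpace.denseSeq X i.2.1) (1 / ((i.2.2 : ℝ) + 1))) := by
  ext x
  simp only [mem_iUnion]
  constructor
  · rintro ⟨y, y', hne, hy, hy'⟩
    obtain ⟨k, hk⟩ := exists_nat_one_div_lt (div_pos (dist_pos.2 hne) (by norm_num : (0 : ℝ) < 4))
    have hk0 : (0 : ℝ) < 1 / ((k : ℝ) + 1) := Nat.one_div_pos_of_nat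
    obtain ⟨n, hn⟩ := (TopologicalSpace.denseRange_denseSeq X).exists_dist_lt y hk0
    obtain ⟨n', hn'⟩ := (TopologicalSpace.denseRange_denseSeq X).exists_dist_lt y' hk0
    refine ⟨(n, n', k), closedBall_disjoint_closedBall ?_,
      ⟨(x, y), ⟨hy, trivial, hn.le⟩, rfl⟩, ⟨(x, y'), ⟨hy', trivial, hn'.le⟩, rfl⟩⟩
    have := dist_triangle4 y (TopologicalSpace.denseSeq X n) (TopologicalSpace.denseSeq X n') y'
    rw [dist_comm (TopologicalSpace.denseSeq X n') y'] at this
    dsimp only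
    linarith
  · rintro ⟨i, hi, ⟨⟨_, y⟩, ⟨hy, -, hyb⟩, rfl⟩, ⟨⟨_, y'⟩, ⟨hy', -, hyb'⟩, rfl⟩⟩
    refine ⟨y, y', ?_, hy, hy'⟩
    rintro rfl
    exact Set.disjoint_left.1 hi hyb hyb'

theorem IsCompact.image_fst_inter_univ_prod (hΓ : IsCompact Γ) {C : Set X} (hC : IsClosed C) :
    IsCompact (Prod.fst '' (Γ ∩ univ ×ˢ C)) :=
  (hΓ.inter_right (isClosed_univ.prod hC)).image continuous_fst

variable [ProperSpace X] [MeasurableSpace X] [BorelSpace X]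

theorem IsCompact.measurableSet_multivaluedSet [Nonempty X] (hΓ : IsCompact Γ) :
    MeasurableSet (multivaluedSet Γ) := by
  rw [multivaluedSet_eq_iUnion]
  refine MeasurableSet.iUnion fun i => MeasurableSet.iUnion fun _ => ?_
  exact (hΓ.image_fst_inter_univ_prod isClosed_closedBall).measurableSet.inter
    (hΓ.image_fst_inter_univ_prod isClosed_closedBall).measurableSet

/-- A compact relation is uniformized by a Borel map off the set where it is multivalued. -/
theorem IsCompact.exists_measurable_of_relation [Nonempty X] (hΓ : IsCompact Γ) :
    ∃ T : X → X, Measurable T ∧ ∀ p ∈ Γ, p.1 ∉ multivaluedSet Γ → p.2 = T p.1 := by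
  classical
  let x₀ : X := Classical.arbitrary X
  have hchoice : ∀ x, ∃ y, (x ∈ Prod.fst '' Γ \ multivaluedSet Γ → (x, y) ∈ Γ) ∧
      (x ∉ Prod.fst '' Γ \ multivaluedSet Γ → y = x₀) := by
    intro x
    by_cases hx : x ∈ Prod.fst '' Γ \ multivaluedSet Γ
    · obtain ⟨⟨p, hp, rfl⟩, -⟩ := id hx
      exact ⟨p.2, fun _ => hp, fun hn => absurd hx hn⟩
    · exact ⟨x₀, fun hx' => absurd hx' hx, fun _ => rfl⟩
  choose T hT hT₀ using hchoice
  have huniq : ∀ p ∈ Γ, p.1 ∉ multivaluedSet Γ → p.2 = T p.1 := by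
    intro p hp hpE
    by_contra hne
    exact hpE ⟨p.2, T p.1, hne, hp, hT _ ⟨⟨p, hp, rfl⟩, hpE⟩⟩
  refine ⟨T, measurable_of_isClosed fun C hC => ?_, huniq⟩
  have hE := hΓ.measurableSet_multivaluedSet
  have hdom : MeasurableSet (Prod.fst '' Γ \ multivaluedSet Γ) :=
    (hΓ.image continuous_fst).measurableSet.diff hE
  have hpre : T ⁻¹' C = (Prod.fst '' (Γ ∩ univ ×ˢ C) \ multivaluedSet Γ) ∪
      ((Prod.fst '' Γ \ multivaluedSet Γ)ᶜ ∩ {_x | x₀ ∈ C}) := by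
    ext x
    by_cases hx : x ∈ Prod.fst '' Γ \ multivaluedSet Γ
    · have hr : x ∉ (Prod.fst '' Γ \ multivaluedSet Γ)ᶜ ∩ {_x | x₀ ∈ C} := fun hr => hr.1 hx
      rw [mem_union, or_iff_left hr]
      constructor
      · exact fun hxC => ⟨⟨(x, T x), ⟨hT x hx, trivial, hxC⟩, rfl⟩, hx.2⟩
      · rintro ⟨⟨p, ⟨hp, -, hpC⟩, rfl⟩, hpE⟩
        rw [mem_preimage, ← huniq p hp hpE]
        exact hpC
    · rw [mem_preimage, hT₀ x hx]
      constructor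
      · exact fun hxC => Or.inr ⟨hx, hxC⟩
      · rintro (⟨⟨p, ⟨hp, -⟩, rfl⟩, hpE⟩ | ⟨-, hxC⟩)
        · exact absurd ⟨⟨p, hp, rfl⟩, hpE⟩ hx
        · exact hxC
  rw [hpre]
  exact ((hΓ.image_fst_inter_univ_prod hC).measurableSet.diff hE).union
    (hdom.compl.inter (MeasurableSet.const _))

end Fibers

end Auxiliary

theorem existence_and_uniqueness_of_optimal_map
    {X : Type*} [MetricSpace X] [ProperSpace X] [CompleteSpace X]
    [TopologicalSpace.SeparableSpace X] [MeasurableSpace X] [BorelSpace X]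
    (hgeo : GeodesicMetricSpace X) (hnb : NonBranching X)
    (m : Measure X) [IsFiniteMeasureOnCompacts m]
    (f : ℝ → ℝ) (hm : EvolutionEstimate m f)
    (h : ℝ → ℝ) (hconv : StrictConvexOn ℝ (Set.Ici (0:ℝ)) h)
    (hmono : MonotoneOn h (Set.Ici (0:ℝ))) (hpos : ∀ x ∈ Set.Ici (0:ℝ), 0 ≤ h x)
    (K : Set X) (hK : IsCompact K)
    (hdoub : ∃ C : ENNReal, ∀ x ∈ K, ∀ r : ℝ, 0 < r →
      (m.restrict K) (Metric.closedBall x (2 * r)) ≤ C * (m.restrict K) (Metric.closedBall x r))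
    (φ φc : X → ℝ) (hφ : ContinuousOn φ K) (hφc : ContinuousOn φc K)
    (hpot : ∀ x ∈ K, ∀ y ∈ K, φ x + φc y ≤ h (dist x y))
    (μ₀ μ₁ : Measure X) [IsProbabilityMeasure μ₀] [IsProbabilityMeasure μ₁]
    (hsupp₀ : μ₀ Kᶜ = 0) (hsupp₁ : μ₁ Kᶜ = 0) (hac : μ₀ ≪ m) :
    (∀ π π' : Measure (X × X), IsCoupling π μ₀ μ₁ → IsCoupling π' μ₀ μ₁ →
      π (contactSet h φ φc K) = 1 → π' (contactSet h φ φc K) = 1 → π = π') ∧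
    (∀ π : Measure (X × X), IsCoupling π μ₀ μ₁ → π (contactSet h φ φc K) = 1 →
      ∃ T : X → X, AEMeasurable T m ∧ π = μ₀.map (fun x => (x, T x))) := by
  have : Nonempty X := nonempty_of_isProbabilityMeasure μ₀
  have hcont := hconv.convexOn.continuousOn_Ici_of_monotoneOn hmono
  set Γ := contactSet h φ φc K
  have hΓ : IsCompact Γ := by
    convert isCompact_almostContactSet hcont hK hK hφ hφc 0 using 1
    ext p
    constructor
    · exact fun hp => ⟨⟨hp.1, hp.2.1⟩, by rw [hp.2.2, add_zero]⟩
    · rintro ⟨⟨h1, h2⟩, h3⟩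
      exact ⟨h1, h2, le_antisymm (hpot _ h1 _ h2) (by simpa using h3)⟩
  have hnull : m (multivaluedSet Γ) = 0 := by
    rw [multivaluedSet_eq_iUnion]
    refine measure_iUnion_null fun i => measure_iUnion_null fun hi => ?_
    set C₁ := closedBall (TopologicalSpace.denseSeq X i.1) (1 / ((i.2.2 : ℝ) + 1))
    set C₂ := closedBall (TopologicalSpace.denseSeq X i.2.1) (1 / ((i.2.2 : ℝ) + 1))
    have hAK : Prod.fst '' (Γ ∩ univ ×ˢ C₁) ∩ Prod.fst '' (Γ ∩ univ ×ˢ C₂) ⊆ K := by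
      rintro _ ⟨⟨p, hp, rfl⟩, -⟩
      exact hp.1.1
    refine hm.measure_eq_zero_of_contact_disjoint (h := h) (φ := φ) (φc := φc)
      (B₁ := K ∩ C₁) (B₂ := K ∩ C₂) hgeo hnb hconv hmono
      ((hΓ.image_fst_inter_univ_prod isClosed_closedBall).inter
        (hΓ.image_fst_inter_univ_prod isClosed_closedBall))
      (hK.inter_right isClosed_closedBall) (hK.inter_right isClosed_closedBall)
      (hi.mono inter_subset_right inter_subset_right) (hφ.mono hAK)
      (hφc.mono inter_subset_left) (hφc.mono inter_subset_left)
      (fun x hx y hy => hpot x (hAK hx) y hy.1) (fun x hx y hy => hpot x (hAK hx) y hy.1) ?_ ?_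
    · rintro _ ⟨⟨p, hp, rfl⟩, -⟩
      exact ⟨p.2, ⟨hp.1.2.1, hp.2.2⟩, hp.1.2.2.ge⟩
    · rintro _ ⟨-, ⟨p, hp, rfl⟩⟩
      exact ⟨p.2, ⟨hp.1.2.1, hp.2.2⟩, hp.1.2.2.ge⟩
  obtain ⟨T, hT, hTΓ⟩ := hΓ.exists_measurable_of_relation
  have key : ∀ π : Measure (X × X), IsCoupling π μ₀ μ₁ → π Γ = 1 →
      π = μ₀.map (fun x => (x, T x)) := by
    rintro π ⟨hprob, hfst, -⟩ hπ
    have hΓae : ∀ᵐ p ∂π, p ∈ Γ := (prob_compl_eq_zero_iff hΓ.measurableSet).2 hπ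
    have hEae : ∀ᵐ p ∂π, p.1 ∉ multivaluedSet Γ := by
      have h0 : μ₀ (multivaluedSet Γ) = 0 := hac hnull
      rw [← hfst, Measure.map_apply measurable_fst hΓ.measurableSet_multivaluedSet] at h0
      exact measure_eq_zero_iff_ae_notMem.1 h0
    have hae : (id : X × X → X × X) =ᵐ[π] (fun x => (x, T x)) ∘ Prod.fst := by
      filter_upwards [hΓae, hEae] with p hp hpE
      exact Prod.ext rfl (hTΓ p hp hpE)
    calc π = π.map id := Measure.map_id.symm
      _ = π.map ((fun x => (x, T x)) ∘ Prod.fst) := Measure.map_congr hae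
      _ = μ₀.map (fun x => (x, T x)) := by
        rw [← Measure.map_map (by fun_prop) measurable_fst, hfst]
  exact ⟨fun π π' hc hc' hπ hπ' => (key π hc hπ).trans (key π' hc' hπ').symm,
    fun π hc hπ => ⟨T, hT.aemeasurable, key π hc hπ⟩⟩
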